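/- Theorem (upper bound for the Chromatic Spectrum Coloring problem): Let G be a finite simple graph, and let W be a symmetric nonnegative s×s interference matrix on a spectrum of s ≥ 2 colors. Suppose d > 0 is a common divisor of all entries of W (every W_ij is an integer multiple of d), and let t ≥ 0 be an integer multiple of d satisfying t ≥ (Δ(G)·||W||_∞ − d·(s−1))/s. Then, setting k₀ = ⌈(Δ(G)·||W||_∞ + d)/(t + d)⌉, we have k₀ ≤ s and there exists a coloring c : V(G) → {1,…,k₀} (using only the first k₀ colors of the spectrum) such that I_v(c) ≤ t for every vertex v. In particular, the t-interference chromatic number satisfies χ_t(G,W) ≤ ⌈(Δ(G)·||W||_∞ + d)/(t + d)⌉. -/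

import Mathlib

open Finset

/-- The total interference splits into twice the interference at `v` and a part that does not
involve the color of `v`. -/
theorem sum_interference_eq {V α : Type*} [Fintype V] [DecidableEq V] (G : SimpleGraph V)
    [DecidableRel G.Adj] (W : α → α → ℝ) (hsymm : ∀ i j, W i j = W j i) (c : V → α) (v : V) :
    ∑ a, ∑ u ∈ G.neighborFinset a, W (c u) (c a) =
      2 * ∑ u ∈ G.neighborFinset v, W (c u) (c v) +
        ∑ a ∈ univ.erase v, ∑ u ∈ (G.neighborFinset a).erase v, W (c u) (c a) := by
  have hsplit : ∀ a, ∑ u ∈ G.neighborFinset a, W (c u) (c a) =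
      (if G.Adj v a then W (c a) (c v) else 0) +
        ∑ u ∈ (G.neighborFinset a).erase v, W (c u) (c a) := by
    intro a
    by_cases h : G.Adj v a
    · rw [if_pos h, hsymm, add_sum_erase _ (fun u => W (c u) (c a)) (by simpa using h.symm)]
    · rw [if_neg h, erase_eq_of_notMem (by simpa [G.adj_comm] using h), zero_add]
  have hstar : ∑ a ∈ univ.erase v, (if G.Adj v a then W (c a) (c v) else 0) =
      ∑ u ∈ G.neighborFinset v, W (c u) (c v) := by
    rw [sum_erase _ (by simp), G.neighborFinset_eq_filter, sum_filter]
  rw [← add_sum_erase univ _ (mem_univ v), sum_congr rfl fun a _ => hsplit a,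
    sum_add_distrib, hstar]
  ring

/-- Some coloring with colors from `C` is stable: no vertex can lower its interference by
switching to another color of `C`. -/
theorem exists_stable_coloring {V α : Type*} [Fintype V] (G : SimpleGraph V)
    [DecidableRel G.Adj] (W : α → α → ℝ) (hsymm : ∀ i j, W i j = W j i)
    (C : Finset α) (hC : C.Nonempty) :
    ∃ c : V → α, (∀ v, c v ∈ C) ∧ ∀ v, ∀ j ∈ C,
      ∑ u ∈ G.neighborFinset v, W (c u) (c v) ≤ ∑ u ∈ G.neighborFinset v, W (c u) j := by
  classical
  obtain ⟨i, hi⟩ := hC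
  obtain ⟨c, hc, hmin⟩ := exists_min_image (Fintype.piFinset fun _ : V => C)
    (fun c => ∑ a, ∑ u ∈ G.neighborFinset a, W (c u) (c a))
    ⟨fun _ => i, by simpa using fun _ => hi⟩
  rw [Fintype.mem_piFinset] at hc
  refine ⟨c, hc, fun v j hj => ?_⟩
  have hle := hmin (Function.update c v j) <| Fintype.mem_piFinset.2 fun a => by
    by_cases h : a = v
    · subst h; simpa using hj
    · simpa [h] using hc a
  rw [sum_interference_eq G W hsymm c v, sum_interference_eq G W hsymm _ v] at hle
  have hstar : ∑ u ∈ G.neighborFinset v,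
      W (Function.update c v j u) (Function.update c v j v) =
      ∑ u ∈ G.neighborFinset v, W (c u) j := by
    refine sum_congr rfl fun u hu => ?_
    have huv : u ≠ v := ((G.mem_neighborFinset v u).1 hu).ne'
    simp [huv]
  have hrest : ∑ a ∈ univ.erase v, ∑ u ∈ (G.neighborFinset a).erase v,
      W (Function.update c v j u) (Function.update c v j a) =
      ∑ a ∈ univ.erase v, ∑ u ∈ (G.neighborFinset a).erase v, W (c u) (c a) := by
    refine sum_congr rfl fun a ha => sum_congr rfl fun u hu => ?_
    simp [ne_of_mem_erase ha, ne_of_mem_erase hu]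
  rw [hstar, hrest] at hle
  linarith

/-- Two integer multiples of `d > 0` in strict order differ by at least `d`. -/
theorem add_le_of_lt_of_int_multiples {d x y : ℝ} (hd : 0 < d) (hx : ∃ m : ℤ, x = m * d)
    (hy : ∃ m : ℤ, y = m * d) (hxy : x < y) : x + d ≤ y := by
  obtain ⟨m, rfl⟩ := hx
  obtain ⟨n, rfl⟩ := hy
  have hmn : m + 1 ≤ n := by exact_mod_cast lt_of_mul_lt_mul_right hxy hd.le
  have hcast : (m : ℝ) + 1 ≤ n := by exact_mod_cast hmn
  nlinarith

/-- Upper bound for the Chromatic Spectrum Coloring problem (threshold a multiple of the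
common divisor `d` of the entries of `W`): with `k₀ = ⌈(Δ(G)·‖W‖_∞ + d)/(t + d)⌉` we have
`k₀ ≤ s` and there is a coloring using only the first `k₀` colors of the spectrum whose
interference at every vertex is at most `t`. -/
theorem CSC_upper_bound {V : Type*} [Fintype V] (G : SimpleGraph V)
    [DecidableRel G.Adj] (s : ℕ) (hs : 2 ≤ s) (W : Fin s → Fin s → ℝ)
    (hsymm : ∀ i j, W i j = W j i) (hnonneg : ∀ i j, 0 ≤ W i j)
    (normW : ℝ) (hnormW : IsGreatest (Set.range fun i : Fin s => ∑ j, W i j) normW)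
    (d : ℝ) (hd : 0 < d) (hdvd : ∀ i j, ∃ m : ℤ, W i j = m * d)
    (t : ℝ) (ht0 : 0 ≤ t) (htmul : ∃ m : ℤ, t = m * d)
    (ht : ((G.maxDegree : ℝ) * normW - d * ((s : ℝ) - 1)) / (s : ℝ) ≤ t) :
    ⌈((G.maxDegree : ℝ) * normW + d) / (t + d)⌉ ≤ (s : ℤ) ∧
    ∃ c : V → Fin s,
      (∀ v : V, ((c v : ℕ) : ℤ) < ⌈((G.maxDegree : ℝ) * normW + d) / (t + d)⌉) ∧
      ∀ v : V, ∑ u ∈ G.neighborFinset v, W (c u) (c v) ≤ t := by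
  have htd : 0 < t + d := by linarith
  have hs0 : (0 : ℝ) < s := by exact_mod_cast (by omega : 0 < s)
  have hrow : ∀ i, ∑ j, W i j ≤ normW := fun i => hnormW.2 ⟨i, rfl⟩
  have hnorm : 0 ≤ normW := by
    obtain ⟨i, rfl⟩ := hnormW.1
    exact sum_nonneg fun j _ => hnonneg i j
  have hks : ⌈((G.maxDegree : ℝ) * normW + d) / (t + d)⌉ ≤ (s : ℤ) := by
    rw [Int.ceil_le, div_le_iff₀ htd]
    rw [div_le_iff₀ hs0] at ht
    push_cast
    linarith
  have hk0 : 0 < ⌈((G.maxDegree : ℝ) * normW + d) / (t + d)⌉ := Int.ceil_pos.2 (by positivity)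
  have hk := Int.le_ceil (((G.maxDegree : ℝ) * normW + d) / (t + d))
  rw [div_le_iff₀ htd] at hk
  refine ⟨hks, ?_⟩
  generalize ⌈((G.maxDegree : ℝ) * normW + d) / (t + d)⌉ = k at hks hk0 hk ⊢
  lift k to ℕ using hk0.le
  have hks' : k ≤ s := by exact_mod_cast hks
  have hk0' : 0 < k := by exact_mod_cast hk0
  obtain ⟨C, hC, hcard⟩ : ∃ C : Finset (Fin s), (∀ i ∈ C, (i : ℕ) < k) ∧ #C = k :=
    ⟨univ.filter fun i => (i : ℕ) < k, by simp, by rw [Fin.card_filter_val_lt, min_eq_right hks']⟩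
  obtain ⟨c, hc, hstable⟩ :=
    exists_stable_coloring G W hsymm C (card_pos.1 (by rwa [hcard]))
  refine ⟨c, fun v => by exact_mod_cast hC _ (hc v), fun v => ?_⟩
  by_contra! hlt
  have hmul : ∃ m : ℤ, ∑ u ∈ G.neighborFinset v, W (c u) (c v) = m * d := by
    choose m hm using hdvd
    exact ⟨∑ u ∈ G.neighborFinset v, m (c u) (c v), by
      push_cast
      rw [sum_mul]
      exact sum_congr rfl fun u _ => hm _ _⟩
  have hgap := add_le_of_lt_of_int_multiples hd htmul hmul hlt
  have hlower : (k : ℝ) * (t + d) ≤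
      ∑ j ∈ C, ∑ u ∈ G.neighborFinset v, W (c u) j := by
    have h := card_nsmul_le_sum _ _ (t + d) fun j hj => hgap.trans (hstable v j hj)
    rwa [hcard, nsmul_eq_mul] at h
  have hupper : ∑ j ∈ C, ∑ u ∈ G.neighborFinset v, W (c u) j ≤
      (G.maxDegree : ℝ) * normW := by
    rw [sum_comm]
    calc ∑ u ∈ G.neighborFinset v, ∑ j ∈ C, W (c u) j
        ≤ ∑ u ∈ G.neighborFinset v, normW := sum_le_sum fun u _ =>
          (sum_le_univ_sum_of_nonneg fun j => hnonneg (c u) j).trans (hrow (c u))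
      _ = (G.degree v : ℝ) * normW := by simp
      _ ≤ (G.maxDegree : ℝ) * normW := by
          gcongr
          exact G.degree_le_maxDegree v
  push_cast at hk
  linarith
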